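/- Assume in addition that χ is continuously differentiable with ‖Dχ‖_∞ ≤ K for some K > 0, that d_min ≤ 2W, and that 3W ≤ 1. Then there is a constant C > 0 depending only on K such that for every x ∈ ℝ³: ‖∫_{ℝ³} D(χ_{d_min}Φ)(x − T(y)) dμ(y) − ∫_{ℝ³} DΦ(x − y) dμ(y)‖ ≤ C·(M + 1)·W·(1 + |log W| + W²/d_min²), where D(χ_{d_min}Φ) is the Fréchet derivative of the (everywhere continuously differentiable) truncated kernel and DΦ is the Fréchet derivative of the Oseen tensor (the second integrand being absolutely integrable since ‖DΦ(z)‖ ≲ ‖z‖⁻²). -/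

import Mathlib

open MeasureTheory
open scoped ENNReal NNReal

noncomputable section

/-- Euclidean `ℝ³`. -/
abbrev E3 : Type := EuclideanSpace ℝ (Fin 3)

/-- The Oseen tensor `Φ(x) = (1/(8π)) (‖x‖⁻¹ I + ‖x‖⁻³ x xᵀ)`, viewed as a continuous
linear map on `ℝ³` (the outer product `x xᵀ` acts as `y ↦ ⟪x, y⟫ x`); for `x = 0` the
formula gives `0` by the convention `0⁻¹ = 0`. -/
def oseenTensor (x : E3) : E3 →L[ℝ] E3 :=
  (8 * Real.pi)⁻¹ • (‖x‖⁻¹ • ContinuousLinearMap.id ℝ E3 +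
    (‖x‖ ^ 3)⁻¹ • (innerSL ℝ x).smulRight x)

/-- The truncated Oseen kernel `(χ_d Φ)(z) = χ(z/d) Φ(z)` (equal to `0` at `z = 0`,
since `χ` vanishes near the origin). -/
def truncOseen (χ : E3 → ℝ) (d : ℝ) (z : E3) : E3 →L[ℝ] E3 :=
  χ (d⁻¹ • z) • oseenTensor z

section

set_option maxSynthPendingDepth 3

section Homogeneous

variable {F : Type*} [NormedAddCommGroup F] [NormedSpace ℝ F]

/-- The derivative of a positively homogeneous function of degree `-n` is positively homogeneous
of degree `-(n + 1)`. -/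
lemma fderiv_smul_of_homogeneous {f : E3 → F} {n : ℕ}
    (hf : ∀ t : ℝ, 0 < t → ∀ z, f (t • z) = (t ^ n)⁻¹ • f z) (t : ℝ) (ht : 0 < t) (z : E3) :
    fderiv ℝ f (t • z) = (t ^ (n + 1))⁻¹ • fderiv ℝ f z := by
  have h : (fun z => f (t • z)) = (t ^ n)⁻¹ • f := funext fun z => hf t ht z
  have h2 : fderiv ℝ (fun z => f (t • z)) z = t • fderiv ℝ f (t • z) := fderiv_comp_smul t
  rw [h, fderiv_const_smul_field, Pi.smul_apply] at h2
  rw [pow_succ, mul_inv_rev, mul_smul, h2, smul_smul, inv_mul_cancel₀ ht.ne', one_smul]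

/-- A positively homogeneous function of degree `-n`, `n ≥ 1`, that is continuous away from the
origin is bounded by a multiple of `‖z‖⁻ⁿ`. -/
lemma exists_norm_le_of_homogeneous {f : E3 → F} {n : ℕ} (hn : n ≠ 0)
    (hf : ∀ t : ℝ, 0 < t → ∀ z, f (t • z) = (t ^ n)⁻¹ • f z)
    (hc : ∀ z, z ≠ 0 → ContinuousAt f z) :
    ∃ C : ℝ, 0 < C ∧ ∀ z, ‖f z‖ ≤ C * (‖z‖ ^ n)⁻¹ := by
  obtain ⟨C, hC⟩ := (isCompact_sphere (0 : E3) 1).exists_bound_of_continuousOn (f := f)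
    fun z hz => (hc z (ne_zero_of_mem_unit_sphere ⟨z, hz⟩)).continuousWithinAt
  refine ⟨max C 1, by positivity, fun z => ?_⟩
  rcases eq_or_ne z 0 with rfl | hz
  · have h := hf 2 two_pos 0
    have h0 : f 0 = 0 := by
      rw [smul_zero] at h
      by_contra hne
      have h1 : ((2 : ℝ) ^ n)⁻¹ < 1 := inv_lt_one_of_one_lt₀ (one_lt_pow₀ one_lt_two hn)
      have h2 := congrArg norm h
      rw [norm_smul, Real.norm_of_nonneg (by positivity)] at h2
      nlinarith [norm_pos_iff.2 hne]
    simp [h0, hn]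
  · have hz' : 0 < ‖z‖ := norm_pos_iff.2 hz
    have h := hf ‖z‖ hz' (‖z‖⁻¹ • z)
    rw [smul_inv_smul₀ hz'.ne'] at h
    rw [h, norm_smul, Real.norm_of_nonneg (by positivity), mul_comm]
    gcongr
    refine (hC _ ?_).trans (le_max_left _ _)
    simp [norm_smul, hz'.ne']

end Homogeneous

lemma oseenTensor_smul (t : ℝ) (ht : 0 < t) (z : E3) :
    oseenTensor (t • z) = (t ^ 1)⁻¹ • oseenTensor z := by
  have h : (innerSL ℝ (t • z)).smulRight (t • z) = t ^ 2 • (innerSL ℝ z).smulRight z := by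
    ext1 w
    simp [smul_smul]
    ring_nf
  simp only [oseenTensor, h, norm_smul, Real.norm_of_nonneg ht.le, smul_add, smul_smul]
  congr 2
  · ring
  · rw [mul_pow, mul_inv]
    field_simp

lemma contDiffAt_oseenTensor {z : E3} (hz : z ≠ 0) : ContDiffAt ℝ 2 oseenTensor z := by
  have h1 : ContDiffAt ℝ 2 (fun z : E3 => ‖z‖) z := contDiffAt_norm ℝ hz
  have hz' : ‖z‖ ≠ 0 := norm_ne_zero_iff.2 hz
  have h2 : ContDiffAt ℝ 2 (fun z : E3 => (innerSL ℝ z).smulRight z) z :=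
    ContDiffAt.smulRight (innerSL ℝ).contDiff.contDiffAt contDiffAt_id
  have h3 : ContDiffAt ℝ 2 (fun z : E3 => ‖z‖⁻¹ • ContinuousLinearMap.id ℝ E3) z :=
    (h1.inv hz').smul contDiffAt_const
  have h4 : ContDiffAt ℝ 2 (fun z : E3 => (‖z‖ ^ 3)⁻¹ • (innerSL ℝ z).smulRight z) z :=
    ((h1.pow 3).inv (pow_ne_zero 3 hz')).smul h2
  exact (h3.add h4).const_smul (8 * Real.pi)⁻¹

lemma exists_norm_oseenTensor_le : ∃ C : ℝ, 0 < C ∧ ∀ z, ‖oseenTensor z‖ ≤ C * ‖z‖⁻¹ := by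
  simpa using exists_norm_le_of_homogeneous one_ne_zero oseenTensor_smul
    fun z hz => (contDiffAt_oseenTensor hz).continuousAt

lemma exists_norm_fderiv_oseenTensor_le :
    ∃ C : ℝ, 0 < C ∧ ∀ z, ‖fderiv ℝ oseenTensor z‖ ≤ C * (‖z‖ ^ 2)⁻¹ :=
  exists_norm_le_of_homogeneous two_ne_zero (fderiv_smul_of_homogeneous oseenTensor_smul)
    fun _ hz => ((contDiffAt_oseenTensor hz).fderiv_right (m := 1) le_rfl).continuousAt

lemma exists_norm_fderiv_fderiv_oseenTensor_le :
    ∃ C : ℝ, 0 < C ∧ ∀ z, ‖fderiv ℝ (fderiv ℝ oseenTensor) z‖ ≤ C * (‖z‖ ^ 3)⁻¹ :=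
  exists_norm_le_of_homogeneous three_ne_zero
    (fderiv_smul_of_homogeneous (fderiv_smul_of_homogeneous oseenTensor_smul))
    fun _ hz => (((contDiffAt_oseenTensor hz).fderiv_right (m := 1) le_rfl).fderiv_right
      (m := 0) le_rfl).continuousAt

/-- Away from the origin, the derivative of the Oseen tensor is Lipschitz on small balls, with the
constant dictated by homogeneity. -/
lemma exists_norm_fderiv_oseenTensor_sub_le :
    ∃ C : ℝ, 0 < C ∧ ∀ (W : ℝ) (u v : E3), 3 * W < ‖v‖ → ‖u - v‖ ≤ W →
      ‖fderiv ℝ oseenTensor u - fderiv ℝ oseenTensor v‖ ≤ C * W * (‖v‖ ^ 3)⁻¹ := by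
  obtain ⟨C, hC, h⟩ := exists_norm_fderiv_fderiv_oseenTensor_le
  refine ⟨C * (27 / 8), by positivity, fun W u v hv huv => ?_⟩
  have hW : 0 ≤ W := (norm_nonneg _).trans huv
  have hv0 : 0 < ‖v‖ := by linarith
  have hball : ∀ w ∈ Metric.closedBall v W, 2 / 3 * ‖v‖ ≤ ‖w‖ := fun w hw => by
    rw [mem_closedBall_iff_norm] at hw
    have := norm_sub_norm_le v w
    rw [norm_sub_rev] at this
    linarith
  have hne : ∀ w ∈ Metric.closedBall v W, w ≠ 0 := fun w hw =>
    norm_pos_iff.1 ((by positivity : 0 < 2 / 3 * ‖v‖).trans_le (hball w hw))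
  have hmv := Convex.norm_image_sub_le_of_norm_fderiv_le (𝕜 := ℝ) (f := fderiv ℝ oseenTensor)
    (s := Metric.closedBall v W) (C := C * ((2 / 3 * ‖v‖) ^ 3)⁻¹) (x := v) (y := u)
    (fun w hw => ((contDiffAt_oseenTensor (hne w hw)).fderiv_right (m := 1) le_rfl).differentiableAt
      one_ne_zero)
    (fun w hw => (h w).trans (by gcongr; exact hball w hw))
    (convex_closedBall v W) (Metric.mem_closedBall_self hW) (mem_closedBall_iff_norm.2 huv)
  calc _ ≤ C * ((2 / 3 * ‖v‖) ^ 3)⁻¹ * ‖u - v‖ := hmv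
    _ ≤ C * ((2 / 3 * ‖v‖) ^ 3)⁻¹ * W := by gcongr
    _ = _ := by rw [mul_pow, mul_inv]; ring

lemma fderiv_truncOseen_eq {χ : E3 → ℝ} (hχ : ∀ z : E3, 1 / 2 ≤ ‖z‖ → χ z = 1) {d : ℝ}
    (hd : 0 < d) {z : E3} (hz : d / 2 < ‖z‖) :
    fderiv ℝ (truncOseen χ d) z = fderiv ℝ oseenTensor z := by
  refine Filter.EventuallyEq.fderiv_eq ?_
  filter_upwards [(isOpen_lt continuous_const continuous_norm).mem_nhds hz] with w hw
  have hw' : d / 2 < ‖w‖ := hw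
  rw [truncOseen, hχ, one_smul]
  rw [norm_smul, Real.norm_of_nonneg (by positivity), inv_mul_eq_div, le_div_iff₀ hd]
  linarith

/-- The derivative of the truncated kernel is bounded by a multiple of `d⁻²`. -/
lemma exists_norm_fderiv_truncOseen_le (K : ℝ) (hK : 0 < K) :
    ∃ C : ℝ, 0 < C ∧ ∀ χ : E3 → ℝ, (∀ z : E3, χ z ∈ Set.Icc (0 : ℝ) 1) →
      (∀ z : E3, ‖z‖ ≤ 1 / 4 → χ z = 0) → ContDiff ℝ 1 χ → (∀ z : E3, ‖fderiv ℝ χ z‖ ≤ K) →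
      ∀ d : ℝ, 0 < d → ∀ z, ‖fderiv ℝ (truncOseen χ d) z‖ ≤ C * (d ^ 2)⁻¹ := by
  obtain ⟨C₀, hC₀, h₀⟩ := exists_norm_oseenTensor_le
  obtain ⟨C₁, hC₁, h₁⟩ := exists_norm_fderiv_oseenTensor_le
  refine ⟨C₁ * 16 + K * C₀ * 4, by positivity, fun χ hχ hχ0 hχs hχK d hd z => ?_⟩
  rcases lt_or_ge ‖z‖ (d / 4) with hz | hz
  · have : truncOseen χ d =ᶠ[nhds z] fun _ => 0 := by
      filter_upwards [(isOpen_lt continuous_norm continuous_const).mem_nhds hz] with w hw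
      have hw' : ‖w‖ < d / 4 := hw
      rw [truncOseen, hχ0, zero_smul]
      rw [norm_smul, Real.norm_of_nonneg (by positivity), inv_mul_eq_div, div_le_iff₀ hd]
      linarith
    rw [this.fderiv_eq, fderiv_fun_const, Pi.zero_apply, norm_zero]
    positivity
  · have hz0 : z ≠ 0 := norm_pos_iff.1 ((by positivity : 0 < d / 4).trans_le hz)
    have hχd : Differentiable ℝ χ := hχs.differentiable one_ne_zero
    have hχd' : DifferentiableAt ℝ (fun z => χ (d⁻¹ • z)) z :=
      (hχd _).comp z (differentiableAt_id.const_smul d⁻¹)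
    have hfd : fderiv ℝ (truncOseen χ d) z = χ (d⁻¹ • z) • fderiv ℝ oseenTensor z +
        (fderiv ℝ (fun z => χ (d⁻¹ • z)) z).smulRight (oseenTensor z) :=
      fderiv_fun_smul hχd' ((contDiffAt_oseenTensor hz0).differentiableAt two_ne_zero)
    have hcs : fderiv ℝ (fun z => χ (d⁻¹ • z)) z = d⁻¹ • fderiv ℝ χ (d⁻¹ • z) :=
      fderiv_comp_smul d⁻¹
    have hA : ‖χ (d⁻¹ • z) • fderiv ℝ oseenTensor z‖ ≤ C₁ * ((d / 4) ^ 2)⁻¹ := by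
      rw [norm_smul, Real.norm_of_nonneg (hχ _).1]
      calc _ ≤ 1 * (C₁ * (‖z‖ ^ 2)⁻¹) := by
            gcongr
            exacts [(hχ _).2, h₁ z]
        _ ≤ _ := by rw [one_mul]; gcongr
    have hB : ‖(fderiv ℝ (fun z => χ (d⁻¹ • z)) z).smulRight (oseenTensor z)‖ ≤
        d⁻¹ * K * (C₀ * (d / 4)⁻¹) := by
      rw [ContinuousLinearMap.norm_smulRight_apply, hcs, norm_smul,
        Real.norm_of_nonneg (by positivity)]
      gcongr
      · exact hχK _
      · exact (h₀ z).trans (by gcongr)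
    rw [hfd]
    refine (norm_add_le _ _).trans ((add_le_add hA hB).trans_eq ?_)
    field_simp
    ring

lemma radial_integral_le {M : ℝ} (hM : 0 < M) {μ : Measure E3}
    (hμ : ∀ A : Set E3, μ A ≤ ENNReal.ofReal M * volume A) (p : E3) {f : ℝ → ℝ}
    (hf : ∀ r, 0 ≤ f r) (hfi : IntegrableOn (fun r => r ^ 2 * f r) (Set.Ioi 0)) :
    Integrable (fun y => f ‖p - y‖) μ ∧ ∫ y, f ‖p - y‖ ∂μ ≤
      M * (3 * volume.real (Metric.ball (0 : E3) 1)) * ∫ r in Set.Ioi 0, r ^ 2 * f r := by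
  have hle : μ ≤ ENNReal.ofReal M • (volume : Measure E3) := Measure.le_iff.2 fun A _ => by
    simpa using hμ A
  have hi : Integrable (fun y : E3 => f ‖p - y‖) :=
    Integrable.comp_sub_left (f := fun z : E3 => f ‖z‖)
      ((integrable_fun_norm_addHaar volume).2 (by simpa using hfi)) p
  have hi' := hi.smul_measure (ENNReal.ofReal_ne_top (r := M))
  refine ⟨hi'.mono_measure hle, ?_⟩
  refine (integral_mono_measure hle (Filter.Eventually.of_forall fun y => hf _) hi').trans_eq ?_
  rw [integral_smul_measure, integral_sub_left_eq_self (fun z : E3 => f ‖z‖) volume p,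
    integral_fun_norm_addHaar, ENNReal.toReal_ofReal hM.le]
  simp
  ring

lemma near_radial_integral {a : ℝ} (ha : 0 < a) (A B : ℝ) :
    IntegrableOn (fun r => r ^ 2 * (Set.Iic a).indicator (fun r => A + B * (r ^ 2)⁻¹) r)
      (Set.Ioi 0) ∧
    ∫ r in Set.Ioi (0 : ℝ), r ^ 2 * (Set.Iic a).indicator (fun r => A + B * (r ^ 2)⁻¹) r =
      A * a ^ 3 / 3 + B * a := by
  have h : Set.EqOn (fun r => r ^ 2 * (Set.Iic a).indicator (fun r => A + B * (r ^ 2)⁻¹) r)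
      ((Set.Iic a).indicator fun r => A * r ^ 2 + B) (Set.Ioi 0) := fun r hr => by
    have hr' : r ≠ 0 := (Set.mem_Ioi.1 hr).ne'
    by_cases hra : r ∈ Set.Iic a
    · simp only [Set.indicator_of_mem hra]
      field_simp
    · simp only [Set.indicator_of_notMem hra, mul_zero]
  have hc : Continuous fun r : ℝ => A * r ^ 2 + B := by fun_prop
  constructor
  · rw [integrableOn_congr_fun h measurableSet_Ioi, IntegrableOn,
      integrable_indicator_iff measurableSet_Iic, IntegrableOn,
      Measure.restrict_restrict measurableSet_Iic, Set.Iic_inter_Ioi]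
    exact hc.integrableOn_Ioc
  · rw [setIntegral_congr_fun measurableSet_Ioi h, setIntegral_indicator measurableSet_Iic,
      Set.Ioi_inter_Iic, ← intervalIntegral.integral_of_le ha.le,
      intervalIntegral.integral_add (Continuous.intervalIntegrable (by fun_prop) _ _)
        (Continuous.intervalIntegrable (by fun_prop) _ _)]
    simp
    ring

lemma far_radial_integral {a : ℝ} (ha : 0 < a) (ha1 : a ≤ 1) (A : ℝ) :
    IntegrableOn (fun r => r ^ 2 * (Set.Ioc a 1).indicator (fun r => A * (r ^ 3)⁻¹) r)
      (Set.Ioi 0) ∧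
    ∫ r in Set.Ioi (0 : ℝ), r ^ 2 * (Set.Ioc a 1).indicator (fun r => A * (r ^ 3)⁻¹) r =
      A * |Real.log a| := by
  have h : Set.EqOn (fun r => r ^ 2 * (Set.Ioc a 1).indicator (fun r => A * (r ^ 3)⁻¹) r)
      ((Set.Ioc a 1).indicator fun r => A * r⁻¹) (Set.Ioi 0) := fun r hr => by
    have hr' : r ≠ 0 := (Set.mem_Ioi.1 hr).ne'
    by_cases hra : r ∈ Set.Ioc a 1
    · simp only [Set.indicator_of_mem hra]
      field_simp
    · simp only [Set.indicator_of_notMem hra, mul_zero]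
  have hsub : Set.Ioi 0 ∩ Set.Ioc a 1 = Set.Ioc a 1 :=
    Set.inter_eq_right.2 fun r hr => ha.trans hr.1
  have hI : IntervalIntegrable (fun r : ℝ => r⁻¹) volume a 1 :=
    intervalIntegral.intervalIntegrable_inv (fun r hr => by
      rw [Set.uIcc_of_le ha1] at hr
      exact (ha.trans_le hr.1).ne') continuousOn_id
  constructor
  · rw [integrableOn_congr_fun h measurableSet_Ioi, IntegrableOn,
      integrable_indicator_iff measurableSet_Ioc, IntegrableOn,
      Measure.restrict_restrict measurableSet_Ioc, Set.inter_comm, hsub]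
    exact ((intervalIntegrable_iff_integrableOn_Ioc_of_le ha1).1 hI).const_mul A
  · rw [setIntegral_congr_fun measurableSet_Ioi h, setIntegral_indicator measurableSet_Ioc,
      hsub, ← intervalIntegral.integral_of_le ha1, intervalIntegral.integral_const_mul,
      integral_inv_of_pos ha one_pos, one_div, Real.log_inv,
      abs_of_nonpos (Real.log_nonpos ha.le ha1)]

/-- The derivative of the Oseen tensor is integrable against measures of bounded density. -/
lemma integrable_fderiv_oseenTensor {M : ℝ} (hM : 0 < M) {μ : Measure E3} [IsFiniteMeasure μ]
    (hμ : ∀ A : Set E3, μ A ≤ ENNReal.ofReal M * volume A) (p : E3) :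
    Integrable (fun y => fderiv ℝ oseenTensor (p - y)) μ := by
  obtain ⟨C, hC, h⟩ := exists_norm_fderiv_oseenTensor_le
  have hi := (radial_integral_le hM hμ p
    (f := (Set.Iic 1).indicator fun r => 0 + C * (r ^ 2)⁻¹)
    (fun r => Set.indicator_nonneg (fun r _ => by positivity) r)
    (near_radial_integral one_pos 0 C).1).1
  refine (hi.add (integrable_const C)).mono' ?_ (Filter.Eventually.of_forall fun y => ?_)
  · exact ((measurable_fderiv ℝ oseenTensor).comp
      (measurable_const.sub measurable_id)).aestronglyMeasurable
  · refine (h _).trans ?_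
    rw [Pi.add_apply]
    by_cases hy : ‖p - y‖ ∈ Set.Iic 1
    · rw [Set.indicator_of_mem hy]
      linarith
    · rw [Set.indicator_of_notMem hy, zero_add]
      have : 1 < ‖p - y‖ := not_le.1 hy
      exact mul_le_of_le_one_right hC.le (inv_le_one_of_one_le₀ (one_le_pow₀ this.le))

/-- The convergence estimate for a measure with density at most `M` and a map `T` displacing
points by at most `W`. -/
lemma exists_norm_integral_fderiv_truncOseen_sub_le (K : ℝ) (hK : 0 < K) :
    ∃ C : ℝ, 0 < C ∧ ∀ χ : E3 → ℝ, (∀ z : E3, χ z ∈ Set.Icc (0 : ℝ) 1) →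
      (∀ z : E3, ‖z‖ ≤ 1 / 4 → χ z = 0) → (∀ z : E3, 1 / 2 ≤ ‖z‖ → χ z = 1) →
      ContDiff ℝ 1 χ → (∀ z : E3, ‖fderiv ℝ χ z‖ ≤ K) →
      ∀ (M W d : ℝ) (μ : Measure E3) (T : E3 → E3), 0 < M → 0 < W → IsProbabilityMeasure μ →
      (∀ A : Set E3, μ A ≤ ENNReal.ofReal M * volume A) → Measurable T →
      (∀ᵐ y ∂μ, ‖T y - y‖ ≤ W) → 0 < d → d ≤ 2 * W → 3 * W ≤ 1 → ∀ p : E3,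
      ‖(∫ y, fderiv ℝ (truncOseen χ d) (p - T y) ∂μ)
          - ∫ y, fderiv ℝ oseenTensor (p - y) ∂μ‖
        ≤ C * (M + 1) * W * (1 + |Real.log W| + W ^ 2 / d ^ 2) := by
  obtain ⟨C₁, hC₁, h₁⟩ := exists_norm_fderiv_oseenTensor_le
  obtain ⟨C₂, hC₂, h₂⟩ := exists_norm_fderiv_truncOseen_le K hK
  obtain ⟨L, hL, hLip⟩ := exists_norm_fderiv_oseenTensor_sub_le
  set V : ℝ := 3 * volume.real (Metric.ball (0 : E3) 1)
  have hV0 : 0 ≤ V := by positivity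
  refine ⟨V * (9 * C₂ + 3 * C₁ + L) + L, by positivity, ?_⟩
  intro χ hχ hχ0 hχ1 hχs hχK M W d μ T hM hW _ hμ hT hTW hd hdW hW1 p
  have h3W : 0 < 3 * W := by positivity
  set f₁ : ℝ → ℝ := (Set.Iic (3 * W)).indicator
    (fun r => C₂ * (d ^ 2)⁻¹ + C₁ * (r ^ 2)⁻¹)
  set f₂ : ℝ → ℝ := (Set.Ioc (3 * W) 1).indicator (fun r => L * W * (r ^ 3)⁻¹)
  have hf₁0 : ∀ r, 0 ≤ f₁ r := fun r => Set.indicator_nonneg (fun r _ => by positivity) r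
  have hf₂0 : ∀ r, 0 ≤ f₂ r := fun r => Set.indicator_nonneg (fun r hr => by
    have : 0 < r := h3W.trans hr.1
    positivity) r
  obtain ⟨hi₁, hI₁⟩ := near_radial_integral h3W (C₂ * (d ^ 2)⁻¹) C₁
  obtain ⟨hi₂, hI₂⟩ := far_radial_integral h3W hW1 (L * W)
  obtain ⟨hr₁, hR₁⟩ := radial_integral_le hM hμ p hf₁0 hi₁
  obtain ⟨hr₂, hR₂⟩ := radial_integral_le hM hμ p hf₂0 hi₂
  rw [hI₁] at hR₁
  rw [hI₂] at hR₂
  have hG : Integrable (fun y => fderiv ℝ (truncOseen χ d) (p - T y)) μ :=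
    (integrable_const (C₂ * (d ^ 2)⁻¹)).mono'
      ((measurable_fderiv ℝ (truncOseen χ d)).comp
        (measurable_const.sub hT)).aestronglyMeasurable
      (Filter.Eventually.of_forall fun y => h₂ χ hχ hχ0 hχs hχK d hd _)
  rw [← integral_sub hG (integrable_fderiv_oseenTensor hM hμ p)]
  have hpt : ∀ᵐ y ∂μ, ‖fderiv ℝ (truncOseen χ d) (p - T y) - fderiv ℝ oseenTensor (p - y)‖ ≤
      f₁ ‖p - y‖ + f₂ ‖p - y‖ + L * W := by
    filter_upwards [hTW] with y hy
    have huv : ‖(p - T y) - (p - y)‖ ≤ W := by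
      rwa [sub_sub_sub_cancel_left, norm_sub_rev]
    rcases le_or_gt ‖p - y‖ (3 * W) with hle | hlt
    · have h : f₁ ‖p - y‖ = C₂ * (d ^ 2)⁻¹ + C₁ * (‖p - y‖ ^ 2)⁻¹ :=
        Set.indicator_of_mem (Set.mem_Iic.2 hle) _
      have := norm_sub_le (fderiv ℝ (truncOseen χ d) (p - T y)) (fderiv ℝ oseenTensor (p - y))
      have hLW : 0 ≤ L * W := by positivity
      linarith [h₂ χ hχ hχ0 hχs hχK d hd (p - T y), h₁ (p - y), hf₂0 ‖p - y‖]
    · have hu : d / 2 < ‖p - T y‖ := by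
        have := norm_sub_norm_le (p - y) (p - T y)
        rw [norm_sub_rev (p - y) (p - T y)] at this
        linarith
      rw [fderiv_truncOseen_eq hχ1 hd hu]
      refine (hLip W _ _ hlt huv).trans ?_
      rcases le_or_gt ‖p - y‖ 1 with hle1 | hlt1
      · have h : f₂ ‖p - y‖ = L * W * (‖p - y‖ ^ 3)⁻¹ :=
          Set.indicator_of_mem (Set.mem_Ioc.2 ⟨hlt, hle1⟩) _
        have hLW : 0 ≤ L * W := by positivity
        linarith [hf₁0 ‖p - y‖]
      · have h : L * W * (‖p - y‖ ^ 3)⁻¹ ≤ L * W :=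
          mul_le_of_le_one_right (by positivity) (inv_le_one_of_one_le₀ (one_le_pow₀ hlt1.le))
        linarith [hf₁0 ‖p - y‖, hf₂0 ‖p - y‖]
  have hr₁₂ : Integrable (fun y => f₁ ‖p - y‖ + f₂ ‖p - y‖) μ := hr₁.add hr₂
  refine (norm_integral_le_of_norm_le (hr₁₂.add (integrable_const (L * W))) hpt).trans ?_
  have hsum : ∫ y, (f₁ ‖p - y‖ + f₂ ‖p - y‖ + L * W) ∂μ =
      ∫ y, f₁ ‖p - y‖ ∂μ + ∫ y, f₂ ‖p - y‖ ∂μ + L * W := by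
    rw [integral_add hr₁₂ (integrable_const _), integral_add hr₁ hr₂]
    simp
  have hlog : |Real.log (3 * W)| ≤ |Real.log W| := by
    rw [abs_of_nonpos (Real.log_nonpos h3W.le hW1),
      abs_of_nonpos (Real.log_nonpos hW.le (by linarith)), neg_le_neg_iff]
    exact Real.log_le_log hW (by linarith)
  set ℓ := |Real.log W|
  have hℓ0 : 0 ≤ ℓ := abs_nonneg _
  set q := W ^ 2 / d ^ 2 with hq
  have hq0 : 0 ≤ q := by positivity
  have hnear : C₂ * (d ^ 2)⁻¹ * (3 * W) ^ 3 / 3 + C₁ * (3 * W) =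
      W * (9 * C₂ * q + 3 * C₁) := by
    rw [hq]
    field_simp
    ring
  rw [hnear] at hR₁
  have hfar : M * V * (L * W * |Real.log (3 * W)|) ≤ M * V * (L * W * ℓ) := by gcongr
  have hB : 9 * C₂ * q + 3 * C₁ + L * ℓ ≤ (9 * C₂ + 3 * C₁ + L) * (1 + ℓ + q) := by
    have e : (9 * C₂ + 3 * C₁ + L) * (1 + ℓ + q) - (9 * C₂ * q + 3 * C₁ + L * ℓ) =
        9 * C₂ * (1 + ℓ) + 3 * C₁ * (ℓ + q) + L * (1 + q) := by ring
    have : 0 ≤ 9 * C₂ * (1 + ℓ) + 3 * C₁ * (ℓ + q) + L * (1 + q) := by positivity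
    linarith
  calc _ = ∫ y, f₁ ‖p - y‖ ∂μ + ∫ y, f₂ ‖p - y‖ ∂μ + L * W := hsum
    _ ≤ M * V * W * (9 * C₂ * q + 3 * C₁ + L * ℓ) + L * W * 1 := by linarith
    _ ≤ (M + 1) * V * W * ((9 * C₂ + 3 * C₁ + L) * (1 + ℓ + q)) +
        L * W * ((M + 1) * (1 + ℓ + q)) := by
      have h1 : 1 ≤ (M + 1) * (1 + ℓ + q) := one_le_mul_of_one_le_of_one_le
        (by linarith) (by linarith)
      gcongr
      linarith
    _ = _ := by ring

end

/-- for every `K > 0` there is `C > 0` depending only on `K` such that, in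
the transport setting, if moreover `χ` is `C¹` with `‖Dχ‖_∞ ≤ K`, `d_min ≤ 2W` and
`3W ≤ 1`, then for every `x ∈ ℝ³`,
`‖∫ D(χ_{d_min}Φ)(x − T(y)) dμ(y) − ∫ DΦ(x − y) dμ(y)‖
  ≤ C (M + 1) W (1 + |log W| + W²/d_min²)`. -/
theorem truncated_convolution_derivative_convergence :
    ∀ K : ℝ, 0 < K → ∃ C : ℝ, 0 < C ∧
      ∀ (χ : E3 → ℝ),
        (∀ z : E3, χ z ∈ Set.Icc (0 : ℝ) 1) →
        (∀ z : E3, ‖z‖ ≤ 1 / 4 → χ z = 0) →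
        (∀ z : E3, 1 / 2 ≤ ‖z‖ → χ z = 1) →
        ContDiff ℝ 1 χ →
        (∀ z : E3, ‖fderiv ℝ χ z‖ ≤ K) →
      ∀ (N : ℕ) (M W : ℝ) (μ : Measure E3) (T : E3 → E3) (x : Fin N → E3) (dmin : ℝ),
        2 ≤ N → 0 < M → 0 < W →
        IsProbabilityMeasure μ →
        (∀ A : Set E3, μ A ≤ ENNReal.ofReal M * volume A) →
        Measurable T →
        (∀ᵐ y ∂μ, ‖T y - y‖ ≤ W) →
        μ.map T = (N : ℝ≥0∞)⁻¹ • ∑ j : Fin N, Measure.dirac (x j) →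
        dmin = sInf {d : ℝ | ∃ i j : Fin N, i ≠ j ∧ d = ‖x i - x j‖} →
        0 < dmin → dmin ≤ 2 * W → 3 * W ≤ 1 →
        ∀ p : E3,
          ‖(∫ y, fderiv ℝ (truncOseen χ dmin) (p - T y) ∂μ)
              - ∫ y, fderiv ℝ oseenTensor (p - y) ∂μ‖
            ≤ C * (M + 1) * W * (1 + |Real.log W| + W ^ 2 / dmin ^ 2) := by
  intro K hK
  obtain ⟨C, hC, h⟩ := exists_norm_integral_fderiv_truncOseen_sub_le K hK
  refine ⟨C, hC, fun χ hχ hχ0 hχ1 hχs hχK N M W μ T x dmin _ hM hW hprob hμ hT hTW _ _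
    hd hdW hW1 p => ?_⟩
  exact h χ hχ hχ0 hχ1 hχs hχK M W dmin μ T hM hW hprob hμ hT hTW hd hdW hW1 p

end
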